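/- Let Γ = (Σ₁, Σ₂; P₁, P₂) be a two-person game with payoffs bounded below in the co-player's variable. Then every weakly semi-strict Nash equilibrium of Γ is an m-equilibrium of Γ: WSSNE(Γ) ⊆ ME(Γ). -/

import Mathlib

/-- Lower payoff of player 1:
`P♭₁(σ₁,σ₂) = inf { P₁(σ₁,τ) : τ, P₂(σ₁,τ) ≥ P₂(σ₁,σ₂) }`. -/
noncomputable def flat1 {X Y : Type} (P1 P2 : X → Y → ℝ) (σ1 : X) (σ2 : Y) : ℝ :=
  sInf {v : ℝ | ∃ τ : Y, P2 σ1 σ2 ≤ P2 σ1 τ ∧ P1 σ1 τ = v}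

/-- Lower payoff of player 2:
`P♭₂(σ₁,σ₂) = inf { P₂(τ,σ₂) : τ, P₁(τ,σ₂) ≥ P₁(σ₁,σ₂) }`. -/
noncomputable def flat2 {X Y : Type} (P1 P2 : X → Y → ℝ) (σ1 : X) (σ2 : Y) : ℝ :=
  sInf {v : ℝ | ∃ τ : X, P1 σ1 σ2 ≤ P1 τ σ2 ∧ P2 τ σ2 = v}

/-- Nash equilibrium of the two-person game `(X, Y; P1, P2)`. -/
def IsNE {X Y : Type} (P1 P2 : X → Y → ℝ) (s : X × Y) : Prop :=
  (∀ σ1 : X, P1 σ1 s.2 ≤ P1 s.1 s.2) ∧ (∀ σ2 : Y, P2 s.1 σ2 ≤ P2 s.1 s.2)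

/-- Weakly semi-strict Nash equilibrium. -/
def IsWSSNE {X Y : Type} (P1 P2 : X → Y → ℝ) (s : X × Y) : Prop :=
  IsNE P1 P2 s ∧
  (∀ σ1 : X, P1 σ1 s.2 = P1 s.1 s.2 → P2 σ1 s.2 ≥ P2 s.1 s.2) ∧
  (∀ σ2 : Y, P2 s.1 σ2 = P2 s.1 s.2 → P1 s.1 σ2 ≥ P1 s.1 s.2)

/-- The lower payoff of player 1 is at most the payoff. -/
theorem flat1_le {X Y : Type} {P1 P2 : X → Y → ℝ} {σ1 : X}
    (h : BddBelow (Set.range fun σ2 : Y => P1 σ1 σ2)) (σ2 : Y) :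
    flat1 P1 P2 σ1 σ2 ≤ P1 σ1 σ2 := by
  refine csInf_le (h.mono ?_) ⟨σ2, le_rfl, rfl⟩
  rintro _ ⟨τ, -, rfl⟩
  exact ⟨τ, rfl⟩

/-- The lower payoff of player 2 is the lower payoff of player 1 in the game with the
players exchanged. -/
theorem flat2_eq_flat1_swap {X Y : Type} (P1 P2 : X → Y → ℝ) (σ1 : X) (σ2 : Y) :
    flat2 P1 P2 σ1 σ2 = flat1 (fun y x => P2 x y) (fun y x => P1 x y) σ2 σ1 :=
  rfl

/-- If all of the co-player's best replies to `σ1` give player 1 at least what the best reply `σ2`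
gives, then the lower payoff of player 1 is at least the payoff. -/
theorem le_flat1 {X Y : Type} {P1 P2 : X → Y → ℝ} {σ1 : X} {σ2 : Y}
    (hbest : ∀ τ : Y, P2 σ1 τ ≤ P2 σ1 σ2)
    (heq : ∀ τ : Y, P2 σ1 τ = P2 σ1 σ2 → P1 σ1 σ2 ≤ P1 σ1 τ) :
    P1 σ1 σ2 ≤ flat1 P1 P2 σ1 σ2 := by
  refine le_csInf ⟨_, σ2, le_rfl, rfl⟩ ?_
  rintro _ ⟨τ, hτ, rfl⟩
  exact heq τ ((hbest τ).antisymm hτ)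

/-- Every weakly semi-strict Nash equilibrium of a game is an m-equilibrium,
i.e. a Nash equilibrium of the flat game: `WSSNE(Γ) ⊆ ME(Γ)`. -/
theorem WSSNE_subset_ME {X Y : Type} [Nonempty X] [Nonempty Y]
    (P1 P2 : X → Y → ℝ)
    (hB1 : ∀ σ1 : X, BddBelow (Set.range fun σ2 : Y => P1 σ1 σ2))
    (hB2 : ∀ σ2 : Y, BddBelow (Set.range fun σ1 : X => P2 σ1 σ2)) :
    {s : X × Y | IsWSSNE P1 P2 s} ⊆ {s : X × Y | IsNE (flat1 P1 P2) (flat2 P1 P2) s} := by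
  rintro s ⟨⟨h1, h2⟩, h3, h4⟩
  refine ⟨fun σ1 => ?_, fun σ2 => ?_⟩
  · exact (flat1_le (hB1 σ1) s.2).trans ((h1 σ1).trans (le_flat1 h2 h4))
  · rw [flat2_eq_flat1_swap, flat2_eq_flat1_swap]
    exact (flat1_le (hB2 σ2) s.1).trans ((h2 σ2).trans
      (le_flat1 (P1 := fun y x => P2 x y) (P2 := fun y x => P1 x y) h1 h3))
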